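/- Let q be an odd prime power, let k ≥ 2, and let f ∈ F_q[x_1,…,x_k] be an admissible symmetric polynomial of total degree d. Write f(x_1,…,x_k) = Σ_{j=0}^{n} p_j(x_2,…,x_k)·x_1^j, where p_n is not identically zero (so n ≥ 1 since f is nonconstant). Let Z be the set of tuples (u_2,…,u_k) ∈ F_q^{k−1} such that p_n(u_2,…,u_k) ≠ 0 and the univariate polynomial f(x, u_2,…,u_k) ∈ F_q[x] can be written as c·h(x)² for some c ∈ F_q and some monic polynomial h(x) ∈ F_q[x]. Then |Z| ≤ n·d·q^{k−2}; in particular, |Z| ≤ d²·q^{k−2}. -/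

import Mathlib

open MvPolynomial

/-- Substitute: variable `0` of `f` is kept as the polynomial indeterminate `X`, and
variable `j+1` is replaced by `u j`.  This produces the univariate polynomial
`f(x, u_2, …, u_k)`. -/
noncomputable def substX {F : Type*} [Field F] {k : ℕ} (f : MvPolynomial (Fin k) F)
    (u : Fin (k - 1) → F) : Polynomial F :=
  MvPolynomial.aeval (fun i : Fin k =>
    if h : (i : ℕ) = 0 then (Polynomial.X : Polynomial F)
    else Polynomial.C (u ⟨(i : ℕ) - 1, by have := i.isLt; omega⟩)) f

/-- `f` is admissible: not a constant multiple of a square, and the coefficients of `f` as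
a polynomial in `x_1` have no common zero over the algebraic closure. -/
def Admissible {F : Type*} [Field F] {k : ℕ} (f : MvPolynomial (Fin k) F) : Prop :=
  (¬ ∃ (c : F) (g : MvPolynomial (Fin k) F), f = MvPolynomial.C c * g ^ 2) ∧
  ∀ v : Fin (k - 1) → AlgebraicClosure F,
    substX (MvPolynomial.map (algebraMap F (AlgebraicClosure F)) f) v ≠ 0

/-- `f` rewritten as a univariate polynomial in the variable `x_1`, with coefficients
`p_j ∈ F[x_2,…,x_k]`: variable `0` goes to the polynomial indeterminate `X` and variable
`j+1` goes to (the constant polynomial with value) the multivariate variable `X j`. -/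
noncomputable def asPolyX {F : Type*} [Field F] {k : ℕ} (f : MvPolynomial (Fin k) F) :
    Polynomial (MvPolynomial (Fin (k - 1)) F) :=
  MvPolynomial.aeval (fun i : Fin k =>
    if h : (i : ℕ) = 0 then (Polynomial.X : Polynomial (MvPolynomial (Fin (k - 1)) F))
    else Polynomial.C (MvPolynomial.X ⟨(i : ℕ) - 1, by have := i.isLt; omega⟩)) f


noncomputable def auxB {R : Type*} [CommRing R] (w : R) (c : ℕ → R) : ℕ → R
  | 0 => 1
  | (j + 1) => w * (c (j + 1) - ∑ p : Fin j, auxB w c (p + 1) * auxB w c (j - p))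
decreasing_by all_goals omega

theorem aux_sum {R : Type*} [CommRing R] (B : PowerSeries R)
    (hB0 : PowerSeries.coeff 0 B = 1) (j : ℕ) :
    PowerSeries.coeff (j + 1) (B ^ 2) = 2 * PowerSeries.coeff (j + 1) B +
      ∑ p ∈ Finset.range j, PowerSeries.coeff (p + 1) B * PowerSeries.coeff (j - p) B := by
  rw [sq, PowerSeries.coeff_mul, Finset.Nat.sum_antidiagonal_eq_sum_range_succ
      (fun a b => PowerSeries.coeff a B * PowerSeries.coeff b B), Finset.sum_range_succ,
      Finset.sum_range_succ']
  simp only [hB0, Nat.sub_self, Nat.sub_zero, one_mul, mul_one]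
  rw [Finset.sum_congr rfl (g := fun p =>
      PowerSeries.coeff (p + 1) B * PowerSeries.coeff (j - p) B)]
  · ring
  · intro x hx; rw [Nat.add_sub_add_right]

theorem aux_sqrt {R : Type*} [CommRing R] (w : R) (hw : 2 * w = 1) (A : PowerSeries R)
    (hA : PowerSeries.coeff 0 A = 1) :
    ∃ B : PowerSeries R, PowerSeries.coeff 0 B = 1 ∧ B ^ 2 = A := by
  set c : ℕ → R := fun i => PowerSeries.coeff i A with hc
  have h0 : PowerSeries.coeff 0 (PowerSeries.mk (auxB w c)) = 1 := by
    rw [PowerSeries.coeff_mk, auxB]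
  refine ⟨PowerSeries.mk (auxB w c), h0, ?_⟩
  ext i
  rcases i with _ | j
  · rw [hA]
    rw [PowerSeries.coeff_zero_eq_constantCoeff_apply] at h0 ⊢
    rw [map_pow, h0, one_pow]
  · rw [aux_sum _ h0, Finset.sum_range]
    simp only [PowerSeries.coeff_mk]
    rw [auxB, ← mul_assoc, hw]
    simp [hc]

theorem aux_uniq {F : Type*} [Field F] (h2 : (2 : F) ≠ 0) (A B : PowerSeries F)
    (hA : PowerSeries.coeff 0 A = 1) (hB : PowerSeries.coeff 0 B = 1) (h : A ^ 2 = B ^ 2) :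
    A = B := by
  rcases sq_eq_sq_iff_eq_or_eq_neg.1 h with h | h
  · exact h
  · exfalso
    rw [h, map_neg, hB] at hA
    apply h2
    linear_combination -hA

theorem aux_deg {m : ℕ} {F : Type*} [Field F] (h2 : (2 : F) ≠ 0) (d : ℕ)
    (A B : PowerSeries (MvPolynomial (Fin m) F))
    (hB0 : PowerSeries.coeff 0 B = 1) (hB : B ^ 2 = A)
    (hA : ∀ i, (PowerSeries.coeff i A).totalDegree ≤ i * d) (i : ℕ) :
    (PowerSeries.coeff i B).totalDegree ≤ i * d := by
  induction i using Nat.strong_induction_on with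
  | _ i ih =>
  rcases Nat.eq_zero_or_pos i with rfl | hi
  · simp [hB0]
  obtain ⟨j, rfl⟩ : ∃ j, i = j + 1 := ⟨i - 1, by omega⟩
  have h1 := hA (j + 1)
  have h3 : PowerSeries.coeff (j + 1) A = 2 * PowerSeries.coeff (j + 1) B +
      ∑ p ∈ Finset.range j, PowerSeries.coeff (p + 1) B * PowerSeries.coeff (j - p) B := by
    rw [← hB, aux_sum _ hB0]
  have h4 : PowerSeries.coeff (j + 1) B = MvPolynomial.C (2⁻¹ : F) *
      (PowerSeries.coeff (j + 1) A -
      ∑ p ∈ Finset.range j, PowerSeries.coeff (p + 1) B * PowerSeries.coeff (j - p) B) := by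
    rw [h3, add_sub_cancel_right, ← mul_assoc]
    have : (2 : MvPolynomial (Fin m) F) = C (2 : F) := (map_ofNat C 2).symm
    rw [this, ← C_mul, inv_mul_cancel₀ h2, C_1, one_mul]
  rw [h4]
  refine (totalDegree_mul _ _).trans ?_
  rw [totalDegree_C, zero_add]
  refine (totalDegree_sub _ _).trans (max_le h1 ?_)
  refine totalDegree_finsetSum_le ?_
  intro p hp
  have hp := Finset.mem_range.1 hp
  refine (totalDegree_mul _ _).trans ?_
  have := ih (p + 1) (by omega)
  have h5 := ih (j - p) (by omega)
  calc _ ≤ (p + 1) * d + (j - p) * d := by omega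
    _ = (j + 1) * d := by rw [← add_mul]; congr 1; omega

theorem aux_sz {m : ℕ} {F : Type*} [Field F] [Fintype F] (hm : 1 ≤ m)
    (p : MvPolynomial (Fin m) F) (hp : p ≠ 0) (D : ℕ) (hD : p.totalDegree ≤ D)
    (S : Set (Fin m → F)) (hS : ∀ u ∈ S, eval u p = 0) :
    S.ncard ≤ D * Fintype.card F ^ (m - 1) := by
  classical
  have h := schwartz_zippel_totalDegree hp (Finset.univ : Finset F)
  have hsub : S ⊆ ↑(Finset.filter (fun f => eval f p = 0)
      (Fintype.piFinset fun _ : Fin m => (Finset.univ : Finset F))) := by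
    intro u hu
    simp [hS u hu]
  have h1 := Set.ncard_le_ncard hsub (Finset.finite_toSet _)
  rw [Set.ncard_coe_finset] at h1
  refine h1.trans ?_
  set N := (Finset.filter (fun f => eval f p = 0)
      (Fintype.piFinset fun _ : Fin m => (Finset.univ : Finset F))).card
  rw [Finset.card_univ] at h
  have hq : (0 : ℚ≥0) < (Fintype.card F : ℚ≥0) := by exact_mod_cast Fintype.card_pos
  rw [div_le_div_iff₀ (by positivity) hq] at h
  have h' : N * Fintype.card F ≤ p.totalDegree * Fintype.card F ^ m := by exact_mod_cast h
  obtain ⟨t, rfl⟩ : ∃ t, m = t + 1 := ⟨m - 1, by omega⟩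
  rw [pow_succ, ← mul_assoc] at h'
  have h2 := Nat.le_of_mul_le_mul_right h' Fintype.card_pos
  exact h2.trans (Nat.mul_le_mul_right _ hD)

theorem aux_gauss {R : Type*} [CommRing R] [IsDomain R] [UniqueFactorizationMonoid R]
    (P G : Polynomial R) (hP : P.IsPrimitive) (a b : R) (ha : a ≠ 0)
    (h : Polynomial.C a * P = Polynomial.C b * G ^ 2) :
    ∃ (c : R) (H : Polynomial R), IsUnit c ∧ P = Polynomial.C c * H ^ 2 := by
  classical
  let _ : StrongNormalizationMonoid R := UniqueFactorizationMonoid.strongNormalizationMonoid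
  let _ : StrongNormalizedGCDMonoid R := UniqueFactorizationMonoid.toStrongNormalizedGCDMonoid R
  have hG := G.eq_C_content_mul_primPart
  have hH : (G.primPart ^ 2).IsPrimitive := by
    rw [sq]; exact G.isPrimitive_primPart.mul G.isPrimitive_primPart
  have h1 : Polynomial.C a * P = Polynomial.C (b * G.content ^ 2) * G.primPart ^ 2 := by
    rw [h]; conv_lhs => rw [hG]
    simp only [map_mul, map_pow]; ring
  have h2 := congrArg Polynomial.content h1
  rw [Polynomial.content_C_mul, Polynomial.content_C_mul, hP.content_eq_one, hH.content_eq_one,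
    mul_one, mul_one] at h2
  have h3 : Associated a (b * G.content ^ 2) := normalize_eq_normalize_iff_associated.1 h2
  obtain ⟨c, hc⟩ := h3
  refine ⟨c, G.primPart, c.isUnit, ?_⟩
  rw [← hc, map_mul, mul_assoc] at h1
  exact mul_left_cancel₀ (by simpa using ha) h1

theorem aux_prim {m : ℕ} {F : Type*} [Field F] (P : Polynomial (MvPolynomial (Fin m) F))
    (h : ∀ v : Fin m → AlgebraicClosure F,
      P.map (MvPolynomial.aeval v : _ →ₐ[F] AlgebraicClosure F).toRingHom ≠ 0) :
    P.IsPrimitive := by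
  intro r hr
  by_contra hu
  obtain ⟨M, hM, hrM⟩ := exists_max_ideal_of_mem_nonunits hu
  obtain ⟨v, hv⟩ := MvPolynomial.eq_vanishingIdeal_singleton_of_isMaximal (AlgebraicClosure F) hM
  rw [hv, mem_vanishingIdeal_singleton_iff] at hrM
  apply h v
  obtain ⟨Q, rfl⟩ := hr
  rw [Polynomial.map_mul, Polynomial.map_C]
  have : (MvPolynomial.aeval v : _ →ₐ[F] AlgebraicClosure F).toRingHom r = 0 := hrM
  rw [this]; simp

theorem asPolyX_eq {F : Type*} [Field F] {m : ℕ} (f : MvPolynomial (Fin (m + 1)) F) :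
    asPolyX f = finSuccEquiv F m f := by
  have : (MvPolynomial.aeval (fun i : Fin (m + 1) =>
    if h : (i : ℕ) = 0 then (Polynomial.X : Polynomial (MvPolynomial (Fin m) F))
    else Polynomial.C (MvPolynomial.X ⟨(i : ℕ) - 1, by have := i.isLt; omega⟩))) =
      (finSuccEquiv F m).toAlgHom := by
    apply MvPolynomial.algHom_ext
    intro i
    refine Fin.cases ?_ (fun j => ?_) i
    · simp [finSuccEquiv_X_zero]
    · simp [finSuccEquiv_X_succ]
  exact DFunLike.congr_fun this f

theorem substX_eq {F : Type*} [Field F] {m : ℕ} (f : MvPolynomial (Fin (m + 1)) F)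
    (u : Fin m → F) :
    substX f u = (finSuccEquiv F m f).map (MvPolynomial.eval u) := by
  have : (MvPolynomial.aeval (fun i : Fin (m + 1) =>
    if h : (i : ℕ) = 0 then (Polynomial.X : Polynomial F)
    else Polynomial.C (u ⟨(i : ℕ) - 1, by have := i.isLt; omega⟩))) =
      (Polynomial.mapAlgHom (MvPolynomial.aeval u)).comp (finSuccEquiv F m).toAlgHom := by
    apply MvPolynomial.algHom_ext
    intro i
    refine Fin.cases ?_ (fun j => ?_) i
    · simp [finSuccEquiv_X_zero]
    · simp [finSuccEquiv_X_succ]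
  have h := DFunLike.congr_fun this f
  refine Eq.trans h ?_
  simp [Polynomial.coe_mapAlgHom]

theorem substX_map_eq {F K : Type*} [Field F] [Field K] [Algebra F K] {m : ℕ}
    (f : MvPolynomial (Fin (m + 1)) F) (u : Fin m → K) :
    substX (MvPolynomial.map (algebraMap F K) f) u =
      (finSuccEquiv F m f).map (MvPolynomial.aeval u : _ →ₐ[F] K).toRingHom := by
  have : (MvPolynomial.aeval (fun i : Fin (m + 1) =>
    if h : (i : ℕ) = 0 then (Polynomial.X : Polynomial K)
    else Polynomial.C (u ⟨(i : ℕ) - 1, by have := i.isLt; omega⟩))) =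
      (Polynomial.mapAlgHom (MvPolynomial.aeval u)).comp (finSuccEquiv F m).toAlgHom := by
    apply MvPolynomial.algHom_ext
    intro i
    refine Fin.cases ?_ (fun j => ?_) i
    · simp [finSuccEquiv_X_zero]
    · simp [finSuccEquiv_X_succ]
  have h := DFunLike.congr_fun this f
  refine Eq.trans ?_ h
  unfold substX
  rw [MvPolynomial.aeval_map_algebraMap]

/-- The reflected integral normalization, as a power series, and its square root. -/
theorem aux_core {m : ℕ} {F : Type*} [Field F] [Fintype F] (h2 : (2 : F) ≠ 0) (hm : 1 ≤ m)
    (P : Polynomial (MvPolynomial (Fin m) F)) (d : ℕ)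
    (hPd : ∀ i, (P.coeff i).totalDegree ≤ d) (hprim : P.IsPrimitive)
    (hns : ¬ ∃ (c : MvPolynomial (Fin m) F) (H : Polynomial (MvPolynomial (Fin m) F)),
      IsUnit c ∧ P = Polynomial.C c * H ^ 2)
    (S : Set (Fin m → F))
    (hS : ∀ u ∈ S, eval u P.leadingCoeff ≠ 0 ∧ ∃ (c : F) (h : Polynomial F), h.Monic ∧
      P.map (eval u) = Polynomial.C c * h ^ 2) :
    S.ncard ≤ P.natDegree * d * Fintype.card F ^ (m - 1) := by
  classical
  set n := P.natDegree with hn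
  set L := P.leadingCoeff with hL
  have hP0 : P ≠ 0 := hprim.ne_zero
  have hL0 : L ≠ 0 := by simpa [hL] using hP0
  rcases S.eq_empty_or_nonempty with rfl | ⟨u0, hu0⟩
  · simp
  -- facts at a point
  have hpt : ∀ u ∈ S, ∃ h : Polynomial F, h.Monic ∧ n = h.natDegree + h.natDegree ∧
      P.map (eval u) = Polynomial.C (eval u L) * h ^ 2 := by
    intro u hu
    obtain ⟨h1, c, h, hmon, he⟩ := hS u hu
    have hd : (P.map (eval u)).natDegree = n :=
      Polynomial.natDegree_map_of_leadingCoeff_ne_zero _ h1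
    have hl : (P.map (eval u)).leadingCoeff = eval u L :=
      Polynomial.leadingCoeff_map_of_leadingCoeff_ne_zero _ h1
    have hc : c = eval u L := by
      rw [← hl, he, Polynomial.leadingCoeff_mul, (hmon.pow 2).leadingCoeff,
        Polynomial.leadingCoeff_C, mul_one]
    refine ⟨h, hmon, ?_, by rw [he, hc]⟩
    rw [← hd, he, Polynomial.natDegree_C_mul (by rw [hc]; exact h1), hmon.natDegree_pow]
    ring
  obtain ⟨r, hr⟩ : ∃ r, n = r + r := by
    obtain ⟨h, -, hh, -⟩ := hpt u0 hu0
    exact ⟨_, hh⟩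
  set Q := P.integralNormalization with hQ
  have hQn : Q.natDegree = n := Polynomial.natDegree_integralNormalization
  set A := Q.reflect n with hA
  have hA0 : PowerSeries.coeff 0 (A : PowerSeries (MvPolynomial (Fin m) F)) = 1 := by
    rw [Polynomial.coeff_coe, hA, Polynomial.coeff_reflect, Polynomial.revAt_zero]
    exact Polynomial.integralNormalization_coeff_natDegree hP0
  have hAn : ∀ i, n < i → A.coeff i = 0 := by
    intro i hi
    rw [hA, Polynomial.coeff_reflect, Polynomial.revAt_eq_self_of_lt hi]
    exact Polynomial.coeff_eq_zero_of_natDegree_lt (by omega)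
  have hAd : ∀ i, (PowerSeries.coeff i (A : PowerSeries (MvPolynomial (Fin m) F))).totalDegree
      ≤ i * d := by
    intro i
    rcases Nat.eq_zero_or_pos i with rfl | hi
    · rw [hA0]; simp
    rw [Polynomial.coeff_coe]
    by_cases hin : n < i
    · rw [hAn i hin]; simp
    push Not at hin
    rw [hA, Polynomial.coeff_reflect, Polynomial.revAt_le hin,
      Polynomial.integralNormalization_coeff_ne_natDegree (by omega)]
    refine (totalDegree_mul _ _).trans ?_
    have e1 := hPd (n - i)
    have e2 := totalDegree_pow P.leadingCoeff (n - 1 - (n - i))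
    have e3 : (n - 1 - (n - i)) * P.leadingCoeff.totalDegree ≤ (i - 1) * d := by
      have : n - 1 - (n - i) = i - 1 := by omega
      rw [this]
      exact Nat.mul_le_mul_left _ (hPd _)
    have e4 : i * d = d + (i - 1) * d := by
      obtain ⟨t, rfl⟩ : ∃ t, i = t + 1 := ⟨i - 1, by omega⟩
      simp; ring
    rw [e4]
    exact add_le_add e1 (e2.trans e3)
  obtain ⟨B, hB0, hB⟩ := aux_sqrt (C (2⁻¹ : F) : MvPolynomial (Fin m) F)
    (by rw [← map_ofNat C 2, ← C_mul]
        rw [show (OfNat.ofNat 2 : F) = 2 from rfl, mul_inv_cancel₀ h2, C_1])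
    (A : PowerSeries (MvPolynomial (Fin m) F)) hA0
  have hBd := aux_deg h2 d _ B hB0 hB hAd
  -- vanishing at points of S
  have hvan : ∀ u ∈ S, ∀ i, r < i → eval u (PowerSeries.coeff i B) = 0 := by
    intro u hu i hi
    have h1 := (hS u hu).1
    obtain ⟨h, hmon, hdeg, he⟩ := hpt u hu
    have hhr : h.natDegree = r := by omega
    set g := h.scaleRoots (eval u L) with hg
    have hgd : g.natDegree = r := by rw [hg, Polynomial.natDegree_scaleRoots, hhr]
    have hQu : Q.map (eval u) = g * g := by
      have e1 := congrArg (Polynomial.map (eval u)) (Polynomial.integralNormalization_mul_C_leadingCoeff P)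
      rw [Polynomial.map_scaleRoots _ _ _ h1, he, Polynomial.map_mul, Polynomial.map_C,
        Polynomial.mul_scaleRoots_of_noZeroDivisors, Polynomial.scaleRoots_C, sq,
        Polynomial.mul_scaleRoots_of_noZeroDivisors, mul_comm] at e1
      exact mul_left_cancel₀ (by simpa using h1) e1
    have hAu : A.map (eval u) = g.reflect r ^ 2 := by
      rw [hA, ← Polynomial.reflect_map, hQu, hr, Polynomial.reflect_mul _ _ hgd.le hgd.le, sq]
    have hBu : PowerSeries.map (eval u) B = (g.reflect r : Polynomial F) := by
      apply aux_uniq h2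
      · rw [PowerSeries.coeff_map, hB0, map_one]
      · rw [Polynomial.coeff_coe, Polynomial.coeff_reflect, Polynomial.revAt_zero, hg, ← hhr,
          Polynomial.coeff_scaleRoots_natDegree, hmon.leadingCoeff]
      · rw [← map_pow, hB, ← Polynomial.coe_pow, ← hAu, Polynomial.polynomial_map_coe]
    rw [← PowerSeries.coeff_map, hBu, Polynomial.coeff_coe, Polynomial.coeff_reflect,
      Polynomial.revAt_eq_self_of_lt hi]
    exact Polynomial.coeff_eq_zero_of_natDegree_lt (by omega)
  by_cases hex : ∃ i, r < i ∧ i ≤ n ∧ PowerSeries.coeff i B ≠ 0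
  · obtain ⟨i, hi, hin, hne⟩ := hex
    exact aux_sz hm _ hne (n * d) ((hBd i).trans (Nat.mul_le_mul_right _ hin)) S
      (fun u hu => hvan u hu i hi)
  exfalso
  push Not at hex
  apply hns
  set T := PowerSeries.trunc (r + 1) B with hT
  have hTd : T.natDegree ≤ r := by
    have := PowerSeries.natDegree_trunc_lt B r
    rw [hT]; omega
  have hTc : ∀ i ≤ n, T.coeff i = PowerSeries.coeff i B := by
    intro i hi
    rw [hT, PowerSeries.coeff_trunc]
    split_ifs with h
    · rfl
    · exact (hex i (by omega) hi).symm
  have hTA : T * T = A := by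
    ext1 i
    by_cases hi : n < i
    · rw [hAn i hi]
      apply Polynomial.coeff_eq_zero_of_natDegree_lt
      have := Polynomial.natDegree_mul_le (p := T) (q := T)
      omega
    · push Not at hi
      rw [← Polynomial.coeff_coe A, ← hB, sq, PowerSeries.coeff_mul, Polynomial.coeff_mul]
      refine Finset.sum_congr rfl ?_
      intro x hx
      have := Finset.HasAntidiagonal.mem_antidiagonal.1 hx
      rw [hTc _ (by omega), hTc _ (by omega)]
  have hQT : Q = T.reflect r ^ 2 := by
    rw [sq, ← Polynomial.reflect_mul _ _ hTd hTd, hTA, ← hr, hA, Polynomial.reflect_reflect]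
  refine aux_gauss P ((T.reflect r).comp (Polynomial.C L * Polynomial.X)) hprim (L ^ n) L
    (pow_ne_zero _ hL0) ?_
  rw [← Polynomial.pow_comp, ← hQT]
  have e1 : (Q * Polynomial.C L).comp (Polynomial.C L * Polynomial.X) =
      Polynomial.C (L ^ n) * P := by
    rw [hQ, hL, Polynomial.integralNormalization_mul_C_leadingCoeff]
    ext1 i
    rw [Polynomial.comp_C_mul_X_coeff, Polynomial.coeff_scaleRoots, Polynomial.coeff_C_mul]
    by_cases hi : i ≤ n
    · rw [mul_assoc, ← pow_add, Nat.sub_add_cancel hi, mul_comm]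
    · rw [Polynomial.coeff_eq_zero_of_natDegree_lt (by omega)]; simp
  rw [← e1, Polynomial.mul_comp, Polynomial.C_comp, mul_comm]

theorem stmt_7 (q k d : ℕ) (F : Type) [Field F] [Fintype F]
    (hF : Fintype.card F = q) (hq : Odd q) (hk : 2 ≤ k)
    (f : MvPolynomial (Fin k) F) (hsym : f.IsSymmetric) (hdeg : f.totalDegree = d)
    (hadm : Admissible f)
    (n : ℕ) (hn : n = (asPolyX f).natDegree) :
    Set.ncard {u : Fin (k - 1) → F |
        MvPolynomial.eval u (asPolyX f).leadingCoeff ≠ 0 ∧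
        ∃ (c : F) (h : Polynomial F), h.Monic ∧ substX f u = Polynomial.C c * h ^ 2} ≤
      n * d * q ^ (k - 2) ∧
    Set.ncard {u : Fin (k - 1) → F |
        MvPolynomial.eval u (asPolyX f).leadingCoeff ≠ 0 ∧
        ∃ (c : F) (h : Polynomial F), h.Monic ∧ substX f u = Polynomial.C c * h ^ 2} ≤
      d ^ 2 * q ^ (k - 2) := by
  obtain ⟨m, rfl⟩ : ∃ m, k = m + 1 := ⟨k - 1, by omega⟩
  have h2 : (2 : F) ≠ 0 := by
    apply Ring.two_ne_zero
    intro h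
    have := FiniteField.even_card_of_char_two h
    rw [hF] at this
    rcases hq with ⟨t, rfl⟩
    omega
  have hPeq := asPolyX_eq f
  have hnd : n ≤ d := by
    rw [hn, ← hdeg, hPeq]
    exact (natDegree_finSuccEquiv f).trans_le (degreeOf_le_totalDegree f 0)
  have hprim : (finSuccEquiv F m f).IsPrimitive := by
    apply aux_prim
    intro v
    have := hadm.2 v
    rwa [substX_map_eq] at this
  have hns : ¬ ∃ (c : MvPolynomial (Fin m) F) (H : Polynomial (MvPolynomial (Fin m) F)),
      IsUnit c ∧ finSuccEquiv F m f = Polynomial.C c * H ^ 2 := by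
    rintro ⟨c, H, hc, he⟩
    obtain ⟨a, -, rfl⟩ := MvPolynomial.isUnit_iff_eq_C_of_isReduced.1 hc
    apply hadm.1
    refine ⟨a, (finSuccEquiv F m).symm H, ?_⟩
    apply (finSuccEquiv F m).injective
    rw [he, map_mul, map_pow, AlgEquiv.apply_symm_apply]
    congr 1
    exact ((finSuccEquiv F m).commutes a).symm
  have hcd : ∀ i, ((finSuccEquiv F m f).coeff i).totalDegree ≤ d := by
    intro i
    by_cases h0 : (finSuccEquiv F m f).coeff i = 0
    · rw [h0]; simp
    · have := totalDegree_coeff_finSuccEquiv_add_le f i h0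
      omega
  have key := aux_core h2 (show 1 ≤ m by omega) (finSuccEquiv F m f) d hcd hprim hns
    {u : Fin m → F |
        MvPolynomial.eval u (asPolyX f).leadingCoeff ≠ 0 ∧
        ∃ (c : F) (h : Polynomial F), h.Monic ∧ substX f u = Polynomial.C c * h ^ 2} (by
      rintro u ⟨h1, c, h, hm, he⟩
      rw [hPeq] at h1
      rw [substX_eq] at he
      exact ⟨h1, c, h, hm, he⟩)
  have hn' : (finSuccEquiv F m f).natDegree = n := by rw [hn, hPeq]
  rw [hn', hF] at key
  refine ⟨key, key.trans ?_⟩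
  rw [sq]
  exact Nat.mul_le_mul_right _ (Nat.mul_le_mul_right _ hnd)
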